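/- Let n ≥ 3 and let W = D_n be the kernel of the group homomorphism H_n → ZMod 2 sending (t,σ) to ∑_i t_i, so that the sign character of W is ε(t,σ) = sign(σ). Then the sign-isotypic subspace {f ∈ k[W] : w f w⁻¹ = ε(w) f for all w ∈ W} of the group algebra k[W] under the conjugation action has k-dimension equal to A + B, where A is the number of pairs (λ,μ) with λ a partition of some m (0 ≤ m ≤ n) into pairwise distinct odd parts, μ a partition of n−m into pairwise distinct odd parts whose number of parts is even, and λ or μ possibly empty, and where B equals the number of partitions ν of n/2 with an even number of parts if n is even, and B = 0 if n is odd. -/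

import Mathlib

/-- The action of the symmetric group on `Fin n → Multiplicative (ZMod 2)` by permuting
coordinates: `σ · t = t ∘ σ⁻¹`. -/
def hyperPhi (n : ℕ) :
    Equiv.Perm (Fin n) →* MulAut (Fin n → Multiplicative (ZMod 2)) where
  toFun σ := MulEquiv.arrowCongr σ (MulEquiv.refl (Multiplicative (ZMod 2)))
  map_one' := by apply MulEquiv.ext; intro t; rfl
  map_mul' σ τ := by apply MulEquiv.ext; intro t; rfl

/-- The hyperoctahedral group `H_n = (Fin n → Multiplicative (ZMod 2)) ⋊ Perm (Fin n)`,
where `Perm (Fin n)` acts by permuting coordinates. -/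
abbrev Hyper (n : ℕ) : Type :=
  (Fin n → Multiplicative (ZMod 2)) ⋊[hyperPhi n] Equiv.Perm (Fin n)

/-- Conjugation by the group element `s`, as a `k`-linear endomorphism of the group algebra
`k[W]`: it sends `f` to `s * f * s⁻¹`. -/
noncomputable def adConj (k : Type*) [Field k] {W : Type*} [Group W] (s : W) :
    MonoidAlgebra k W →ₗ[k] MonoidAlgebra k W :=
  (LinearMap.mulRight k (MonoidAlgebra.of k W s⁻¹)).comp
    (LinearMap.mulLeft k (MonoidAlgebra.of k W s))

/-- The sign-isotypic subspace `{f ∈ k[W] : w f w⁻¹ = ε(w) f for all w ∈ W}` of the group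
algebra `k[W]` for the conjugation action, where `ε : W → k` is a character. -/
noncomputable def signIsotypic (k : Type*) [Field k] (W : Type*) [Group W] (ε : W → k) :
    Submodule k (MonoidAlgebra k W) :=
  ⨅ w : W, LinearMap.eqLocus (adConj k w) (ε w • LinearMap.id)

/-- A partition has distinct odd parts if all of its parts are odd and pairwise distinct. -/
def DistinctOddParts {m : ℕ} (lam : Nat.Partition m) : Prop :=
  (∀ i ∈ lam.parts, Odd i) ∧ lam.parts.Nodup

namespace Hyper

open Equiv.Perm

/-- The group of signs, written multiplicatively. -/
abbrev Sgn : Type := Multiplicative (ZMod 2)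

theorem Sgn.mul_self (z : Sgn) : z * z = 1 := by
  revert z; decide

/-- The nontrivial sign. -/
def Sgn.neg : Sgn := Multiplicative.ofAdd 1

theorem Sgn.neg_ne_one : Sgn.neg ≠ 1 := by decide

theorem Sgn.eq_one_or (z : Sgn) : z = 1 ∨ z = Sgn.neg := by
  revert z; decide

theorem Sgn.neg_pow_eq_one_iff (m : ℕ) : Sgn.neg ^ m = 1 ↔ Even m := by
  rcases Nat.even_or_odd m with h | h
  · obtain ⟨r, rfl⟩ := h
    simp [pow_add, Sgn.mul_self]
  · obtain ⟨r, rfl⟩ := h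
    have : Sgn.neg ^ (2 * r + 1) = Sgn.neg := by
      rw [pow_succ, pow_mul, pow_two, Sgn.mul_self, one_pow, one_mul]
    rw [this]
    simp [Sgn.neg_ne_one]

variable {n : ℕ}

theorem mul_left_apply (a b : Hyper n) (i : Fin n) :
    (a * b).left i = a.left i * b.left (a.right⁻¹ i) := rfl

theorem mul_left_apply_right (a b : Hyper n) (i : Fin n) :
    (a * b).left (a.right i) = a.left (a.right i) * b.left i := by
  rw [mul_left_apply]; simp

theorem zpow_right (g : Hyper n) (k : ℤ) : (g ^ k).right = g.right ^ k :=
  map_zpow (SemidirectProduct.rightHom : Hyper n →* _) g k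

theorem pow_right (g : Hyper n) (k : ℕ) : (g ^ k).right = g.right ^ k :=
  map_pow (SemidirectProduct.rightHom : Hyper n →* _) g k

/-- The length of the cycle through `i`. -/
def cycLen (g : Hyper n) (i : Fin n) : ℕ :=
  (Finset.univ.filter fun j => g.right.SameCycle i j).card

/-- The sign of the cycle through `i`, the product of the signs along the cycle. -/
def cycSign (g : Hyper n) (i : Fin n) : Sgn :=
  ∏ j ∈ Finset.univ.filter (fun j => g.right.SameCycle i j), g.left j

theorem cycLen_pos (g : Hyper n) (i : Fin n) : 0 < cycLen g i :=
  Finset.card_pos.2 ⟨i, by simpa using SameCycle.refl _ _⟩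

theorem filter_sameCycle_congr {σ : Equiv.Perm (Fin n)} {i j : Fin n} (h : σ.SameCycle i j) :
    Finset.univ.filter (fun x => σ.SameCycle i x) =
      Finset.univ.filter (fun x => σ.SameCycle j x) :=
  Finset.filter_congr fun _ _ => ⟨fun hx => h.symm.trans hx, fun hx => h.trans hx⟩

theorem cycLen_congr {g : Hyper n} {i j : Fin n} (h : g.right.SameCycle i j) :
    cycLen g i = cycLen g j := by
  rw [cycLen, cycLen, filter_sameCycle_congr h]

theorem cycSign_congr {g : Hyper n} {i j : Fin n} (h : g.right.SameCycle i j) :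
    cycSign g i = cycSign g j := by
  rw [cycSign, cycSign, filter_sameCycle_congr h]

theorem zpow_apply_eq_iff (g : Hyper n) (i : Fin n) (k : ℤ) :
    (g.right ^ k) i = i ↔ (cycLen g i : ℤ) ∣ k := by
  classical
  have h := MulAction.zpow_smul_eq_iff_minimalPeriod_dvd (a := g.right) (b := i) (n := k)
  have hc : Function.minimalPeriod (fun x => g.right • x) i = cycLen g i := by
    rw [MulAction.minimalPeriod_eq_card, cycLen, ← Set.toFinset_card]
    congr 1
    ext j
    rw [Finset.mem_filter_univ, Set.mem_toFinset, MulAction.mem_orbit_iff]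
    simp only [SameCycle, Subgroup.smul_def, Equiv.Perm.smul_def, Subtype.exists,
      Subgroup.mem_zpowers_iff, exists_prop, exists_exists_eq_and]
  rw [hc] at h
  exact h

theorem pow_cycLen_apply (g : Hyper n) (i : Fin n) : (g.right ^ cycLen g i) i = i := by
  have := (zpow_apply_eq_iff g i (cycLen g i)).2 dvd_rfl
  simpa using this

theorem pow_left_apply (g : Hyper n) (i : Fin n) (k : ℕ) :
    (g ^ k).left i = ∏ m ∈ Finset.range k, g.left ((g.right ^ (-(m : ℤ))) i) := by
  induction k with
  | zero => rfl
  | succ k ih =>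
    rw [Finset.prod_range_succ, ← ih, pow_succ, mul_left_apply, pow_right]
    simp

theorem pow_cycLen_left (g : Hyper n) (i : Fin n) :
    (g ^ cycLen g i).left i = cycSign g i := by
  rw [pow_left_apply, cycSign]
  have hinj : Set.InjOn (fun m : ℕ => (g.right ^ (-(m : ℤ))) i)
      (Finset.range (cycLen g i) : Set ℕ) := by
    intro a ha b hb hab
    have ha' := Finset.mem_range.1 ha
    have hb' := Finset.mem_range.1 hb
    have h1 : (g.right ^ ((b : ℤ) - a)) i = i := by
      have : (g.right ^ (b : ℤ)) ((g.right ^ (-(a : ℤ))) i) =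
          (g.right ^ (b : ℤ)) ((g.right ^ (-(b : ℤ))) i) := congrArg _ hab
      rw [← Equiv.Perm.mul_apply, ← Equiv.Perm.mul_apply, ← zpow_add, ← zpow_add] at this
      simpa [sub_eq_add_neg] using this
    have h2 := (zpow_apply_eq_iff g i _).1 h1
    have h3 : |(b : ℤ) - a| < cycLen g i := by
      rw [abs_lt]; constructor <;> omega
    have := Int.eq_zero_of_abs_lt_dvd h2 h3
    omega
  have himg : (Finset.range (cycLen g i)).image (fun m : ℕ => (g.right ^ (-(m : ℤ))) i) =
      Finset.univ.filter (fun j => g.right.SameCycle i j) := by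
    apply Finset.eq_of_subset_of_card_le
    · intro j hj
      obtain ⟨m, -, rfl⟩ := Finset.mem_image.1 hj
      simp only [Finset.mem_filter, Finset.mem_univ, true_and]
      exact ⟨_, rfl⟩
    · rw [Finset.card_image_of_injOn hinj, Finset.card_range, cycLen]
  rw [← himg, Finset.prod_image hinj]

theorem zpow_left_of_fixed {h : Hyper n} {i : Fin n} (hi : h.right i = i) (m : ℤ) :
    (h ^ m).left i = (h.left i) ^ m := by
  have step : ∀ k : ℤ, (h ^ (k + 1)).left i = (h ^ k).left i * h.left i := by
    intro k
    have hk : ((h ^ k).right)⁻¹ i = i := by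
      rw [zpow_right, ← zpow_neg]
      exact Equiv.Perm.zpow_apply_eq_self_of_apply_eq_self hi _
    rw [zpow_add_one, mul_left_apply, hk]
  induction m with
  | zero => simp
  | succ m ih => rw [step, ih, zpow_add_one]
  | pred m ih =>
    have h1 := step (-(m : ℤ) - 1)
    rw [sub_add_cancel, ih] at h1
    rw [zpow_sub_one (h.left i), h1, mul_inv_cancel_right]

theorem zpow_left_eq (g : Hyper n) (i : Fin n) (m : ℤ) :
    (g ^ ((cycLen g i : ℤ) * m)).left i = (cycSign g i) ^ m := by
  rw [zpow_mul, zpow_left_of_fixed, zpow_natCast, pow_cycLen_left]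
  rw [zpow_natCast, pow_right]
  exact pow_cycLen_apply g i

theorem right_eq_conj {g g' h : Hyper n} (H : h * g = g' * h) :
    g'.right = h.right * g.right * h.right⁻¹ := by
  have := congrArg SemidirectProduct.right H
  simp only [SemidirectProduct.mul_right] at this
  rw [this, mul_inv_cancel_right]

theorem sameCycle_map {g g' h : Hyper n} (H : h * g = g' * h) (i j : Fin n) :
    g'.right.SameCycle (h.right i) (h.right j) ↔ g.right.SameCycle i j := by
  rw [right_eq_conj H, sameCycle_conj]
  simp

theorem cycLen_map {g g' h : Hyper n} (H : h * g = g' * h) (i : Fin n) :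
    cycLen g' (h.right i) = cycLen g i := by
  symm
  refine Finset.card_equiv h.right fun j => ?_
  rw [Finset.mem_filter_univ, Finset.mem_filter_univ, sameCycle_map H]

theorem prod_sameCycle_apply (σ : Equiv.Perm (Fin n)) (i : Fin n) (F : Fin n → Sgn) :
    ∏ j ∈ Finset.univ.filter (fun j => σ.SameCycle i j), F (σ j) =
      ∏ j ∈ Finset.univ.filter (fun j => σ.SameCycle i j), F j := by
  refine Finset.prod_equiv σ (fun j => ?_) fun _ _ => rfl
  rw [Finset.mem_filter_univ, Finset.mem_filter_univ, sameCycle_apply_right]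

theorem cycSign_map {g g' h : Hyper n} (H : h * g = g' * h) (i : Fin n) :
    cycSign g' (h.right i) = cycSign g i := by
  have h1 : cycSign g' (h.right i) =
      ∏ j ∈ Finset.univ.filter (fun j => g.right.SameCycle i j), g'.left (h.right j) := by
    symm
    refine Finset.prod_equiv h.right (fun j => ?_) fun _ _ => rfl
    rw [Finset.mem_filter_univ, Finset.mem_filter_univ, sameCycle_map H]
  have h2 : ∀ j, g'.left (h.right (g.right j)) =
      h.left (h.right (g.right j)) * g.left (g.right j) * h.left (h.right j) := by
    intro j
    have e : (h * g).left ((h * g).right j) = (g' * h).left ((g' * h).right j) := by rw [H]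
    have e1 : (h * g).left ((h * g).right j) =
        h.left (h.right (g.right j)) * g.left (g.right j) :=
      mul_left_apply_right h g (g.right j)
    have e2 : (g' * h).left ((g' * h).right j) =
        g'.left (g'.right (h.right j)) * h.left (h.right j) :=
      mul_left_apply_right g' h (h.right j)
    have e3 : h.right (g.right j) = g'.right (h.right j) := by
      rw [right_eq_conj H]; simp
    rw [← e1, e, e2, e3, mul_assoc, Sgn.mul_self, mul_one]
  rw [h1, ← prod_sameCycle_apply g.right i (fun j => g'.left (h.right j))]
  simp only [h2]
  rw [Finset.prod_mul_distrib, Finset.prod_mul_distrib,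
    prod_sameCycle_apply g.right i (fun j => h.left (h.right j)),
    prod_sameCycle_apply g.right i g.left, mul_right_comm, Sgn.mul_self, one_mul]
  rfl

theorem zpow_succ_left_apply (g : Hyper n) (k : ℤ) (i : Fin n) :
    (g ^ (k + 1)).left ((g.right ^ (k + 1)) i) =
      g.left ((g.right ^ (k + 1)) i) * (g ^ k).left ((g.right ^ k) i) := by
  rw [add_comm, zpow_add, zpow_one]
  have := mul_left_apply_right g (g ^ k) ((g.right ^ k) i)
  rw [zpow_add, zpow_one]
  exact this

/-- Two signed permutations whose cycles match in length and sign are conjugate, by an element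
matching prescribed base points of the cycles. -/
theorem exists_conj {g g' : Hyper n} {Q : Type*} (cls : Fin n → Q)
    (hcls : ∀ i j, cls i = cls j ↔ g.right.SameCycle i j)
    (r : Q → Fin n) (hr : ∀ q, cls (r q) = q) (r' : Q → Fin n)
    (hr' : ∀ q q', g'.right.SameCycle (r' q) (r' q') → q = q')
    (hlen : ∀ q, cycLen g (r q) = cycLen g' (r' q))
    (hsign : ∀ q, cycSign g (r q) = cycSign g' (r' q)) :
    ∃ h : Hyper n, h * g = g' * h ∧
      (∀ q (k : ℤ), h.right ((g.right ^ k) (r q)) = (g'.right ^ k) (r' q)) ∧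
      ∀ q (k : ℤ), h.left ((g'.right ^ k) (r' q)) =
        (g ^ k).left ((g.right ^ k) (r q)) * (g' ^ k).left ((g'.right ^ k) (r' q)) := by
  have hex : ∀ i, ∃ k : ℤ, (g.right ^ k) (r (cls i)) = i := fun i =>
    (hcls _ _).1 (hr (cls i))
  choose κ hκ using hex
  have hclsz : ∀ q (k : ℤ), cls ((g.right ^ k) (r q)) = q := by
    intro q k
    conv_rhs => rw [← hr q]
    rw [hcls]
    exact (SameCycle.symm ⟨k, rfl⟩)
  have hfix : ∀ q (k l : ℤ), (g.right ^ k) (r q) = (g.right ^ l) (r q) ↔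
      (cycLen g (r q) : ℤ) ∣ k - l := by
    intro q k l
    rw [← zpow_apply_eq_iff, sub_eq_neg_add, zpow_add, Equiv.Perm.mul_apply, zpow_neg,
      Equiv.Perm.inv_eq_iff_eq]
  have hfix' : ∀ q (k l : ℤ), (g'.right ^ k) (r' q) = (g'.right ^ l) (r' q) ↔
      (cycLen g (r q) : ℤ) ∣ k - l := by
    intro q k l
    rw [hlen, ← zpow_apply_eq_iff, sub_eq_neg_add, zpow_add, Equiv.Perm.mul_apply, zpow_neg,
      Equiv.Perm.inv_eq_iff_eq]
  let τ : Fin n → Fin n := fun i => (g'.right ^ κ i) (r' (cls i))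
  have hτ : ∀ q (k : ℤ), τ ((g.right ^ k) (r q)) = (g'.right ^ k) (r' q) := by
    intro q k
    have e := hκ ((g.right ^ k) (r q))
    simp only [τ]
    rw [hclsz] at e ⊢
    rw [hfix']
    exact (hfix _ _ _).1 e
  have hinj : Function.Injective τ := by
    intro i j hij
    have hq : cls i = cls j := by
      apply hr'
      refine SameCycle.trans (y := τ i) ⟨_, rfl⟩ ?_
      rw [hij]
      exact SameCycle.symm ⟨_, rfl⟩
    simp only [τ] at hij
    rw [hq] at hij
    rw [hfix', ← hfix] at hij
    rw [← hκ i, ← hκ j, hq]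
    exact hij
  let e : Equiv.Perm (Fin n) := Equiv.ofBijective τ (Finite.injective_iff_bijective.1 hinj)
  have he : ∀ i, e i = τ i := fun _ => rfl
  let v : Fin n → Sgn := fun i => (g ^ κ i).left i * (g' ^ κ i).left (τ i)
  have hv : ∀ q (k : ℤ), v ((g.right ^ k) (r q)) =
      (g ^ k).left ((g.right ^ k) (r q)) * (g' ^ k).left ((g'.right ^ k) (r' q)) := by
    intro q k
    have e := hκ ((g.right ^ k) (r q))
    rw [hclsz] at e
    obtain ⟨m, hm⟩ := (hfix _ _ _).1 e
    have hk : κ ((g.right ^ k) (r q)) = k + cycLen g (r q) * m := by omega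
    simp only [v]
    rw [hτ, hk]
    have s1 : (g ^ (k + cycLen g (r q) * m)).left ((g.right ^ k) (r q)) =
        (g ^ k).left ((g.right ^ k) (r q)) * (cycSign g (r q)) ^ m := by
      rw [zpow_add, ← zpow_right, mul_left_apply_right, zpow_left_eq]
    have s2 : (g' ^ (k + cycLen g (r q) * m)).left ((g'.right ^ k) (r' q)) =
        (g' ^ k).left ((g'.right ^ k) (r' q)) * (cycSign g (r q)) ^ m := by
      rw [hlen, hsign, zpow_add, ← zpow_right, mul_left_apply_right, zpow_left_eq]
    rw [s1, s2, mul_mul_mul_comm, Sgn.mul_self, mul_one]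
  refine ⟨⟨fun i => v (e.symm i), e⟩, ?_, hτ, ?_⟩
  · have hcomm : ∀ i, e (g.right i) = g'.right (e i) := by
      intro i
      have h1 := hτ (cls i) (κ i + 1)
      have h2 := hτ (cls i) (κ i)
      rw [add_comm, zpow_add, zpow_add, Equiv.Perm.mul_apply, Equiv.Perm.mul_apply, ← h2, hκ] at h1
      simpa [he] using h1
    have hright : e * g.right = g'.right * e := Equiv.ext hcomm
    refine SemidirectProduct.ext ?_ hright
    funext x
    obtain ⟨i, rfl⟩ : ∃ i, x = e (g.right i) := ⟨g.right⁻¹ (e.symm x), by simp⟩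
    have e1 := mul_left_apply_right (⟨fun i => v (e.symm i), e⟩ : Hyper n) g (g.right i)
    have e2 := mul_left_apply_right g' (⟨fun i => v (e.symm i), e⟩ : Hyper n) (e i)
    rw [← hcomm] at e2
    refine e1.trans (Eq.trans ?_ e2.symm)
    simp only [Equiv.symm_apply_apply]
    have k1 : g.right i = (g.right ^ (κ i + 1)) (r (cls i)) := by
      rw [add_comm, zpow_add, Equiv.Perm.mul_apply, hκ]; simp
    have k2 := hv (cls i) (κ i)
    have k3 := hv (cls i) (κ i + 1)
    rw [zpow_succ_left_apply, zpow_succ_left_apply, ← k1, ← hτ, ← k1] at k3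
    rw [hκ, ← hτ, hκ] at k2
    rw [hκ, show (g'.right ^ κ i) (r' (cls i)) = τ i from rfl] at k3
    rw [k3, k2, he]
    have key : ∀ a b c d : Sgn, a * b * (c * d) * a = c * (b * d) := by decide
    exact key _ _ _ _
  · intro q k
    rw [← hv, ← hτ]
    simp only [← he, Equiv.symm_apply_apply]

theorem exists_equiv_of_map_univ_eq {α β γ : Type*} [Fintype α] [Fintype β] (f : α → γ)
    (f' : β → γ) (h : (Finset.univ : Finset α).val.map f = (Finset.univ : Finset β).val.map f') :
    ∃ e : α ≃ β, ∀ a, f' (e a) = f a := by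
  classical
  have hc : ∀ c, Nonempty ({a // f a = c} ≃ {b // f' b = c}) := by
    intro c
    have h1 := congrArg (Multiset.count c) h
    rw [Multiset.count_map, Multiset.count_map] at h1
    refine ⟨Fintype.equivOfCardEq ?_⟩
    rw [Fintype.card_subtype, Fintype.card_subtype]
    simpa only [Finset.card_def, Finset.filter_val, eq_comm] using h1
  exact ⟨Equiv.ofFiberEquiv fun c => (hc c).some, fun a => Equiv.ofFiberEquiv_map _ a⟩

/-- The set of cycles of the underlying permutation. -/
abbrev Orb (g : Hyper n) : Type := Quotient (SameCycle.setoid g.right)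

noncomputable instance (g : Hyper n) : Fintype (Orb g) := Fintype.ofFinite _

theorem orb_mk_eq_iff (g : Hyper n) (i j : Fin n) :
    (Quotient.mk _ i : Orb g) = Quotient.mk _ j ↔ g.right.SameCycle i j :=
  Quotient.eq

theorem sameCycle_out (g : Hyper n) (i : Fin n) :
    g.right.SameCycle (Quotient.mk _ i : Orb g).out i :=
  Quotient.mk_out (s := SameCycle.setoid g.right) i

/-- The signed cycle type: the multiset of pairs (length, sign) over all cycles. -/
noncomputable def cycType (g : Hyper n) : Multiset (ℕ × Sgn) :=
  (Finset.univ : Finset (Orb g)).val.map fun q => (cycLen g q.out, cycSign g q.out)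

theorem mem_cycType (g : Hyper n) (p : ℕ × Sgn) :
    p ∈ cycType g ↔ ∃ i, (cycLen g i, cycSign g i) = p := by
  rw [cycType, Multiset.mem_map]
  constructor
  · rintro ⟨q, -, h⟩
    exact ⟨q.out, h⟩
  · rintro ⟨i, h⟩
    refine ⟨Quotient.mk _ i, Finset.mem_univ _, ?_⟩
    rw [cycLen_congr (sameCycle_out g i), cycSign_congr (sameCycle_out g i), h]

theorem filter_mk_eq (g : Hyper n) [DecidableEq (Orb g)] (q : Orb g) :
    (Finset.univ.filter fun i => (Quotient.mk _ i : Orb g) = q) =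
      Finset.univ.filter fun i => g.right.SameCycle q.out i := by
  ext i
  rw [Finset.mem_filter_univ, Finset.mem_filter_univ, ← orb_mk_eq_iff, Quotient.out_eq, eq_comm]

theorem cycType_map_snd_prod (g : Hyper n) :
    ((cycType g).map Prod.snd).prod = ∏ i, g.left i := by
  classical
  rw [cycType, Multiset.map_map, ← Finset.prod_fiberwise Finset.univ
    (fun i => (Quotient.mk _ i : Orb g)) g.left]
  refine Finset.prod_congr rfl fun q _ => ?_
  rw [filter_mk_eq]
  rfl

theorem cycType_map_fst_sum (g : Hyper n) : ((cycType g).map Prod.fst).sum = n := by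
  classical
  have h : ∑ i : Fin n, 1 = n := by simp
  conv_rhs => rw [← h]
  rw [cycType, Multiset.map_map, ← Finset.sum_fiberwise Finset.univ
    (fun i => (Quotient.mk _ i : Orb g))]
  refine Finset.sum_congr rfl fun q _ => ?_
  rw [filter_mk_eq, ← Finset.card_eq_sum_ones]
  rfl

theorem cycType_eq_of_conj {g g' h : Hyper n} (H : h * g = g' * h) : cycType g = cycType g' := by
  let e : Orb g ≃ Orb g' := Quotient.congr h.right fun i j => (sameCycle_map H i j).symm
  rw [cycType, cycType, ← Multiset.map_univ_val_equiv e, Multiset.map_map]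
  refine Multiset.map_congr rfl fun q _ => ?_
  have hs : g'.right.SameCycle (e q).out (h.right q.out) := by
    rw [← orb_mk_eq_iff, Quotient.out_eq]
    conv_lhs => rw [← Quotient.out_eq q]
    rfl
  simp only [Function.comp_apply]
  rw [cycLen_congr hs, cycSign_congr hs, cycLen_map H, cycSign_map H]

theorem exists_conj_of_cycType_eq {g g' : Hyper n} (h : cycType g = cycType g') :
    ∃ h : Hyper n, h * g = g' * h := by
  obtain ⟨e, he⟩ := exists_equiv_of_map_univ_eq _ _ h
  obtain ⟨h, hh, -⟩ := exists_conj (g := g) (g' := g') (Q := Orb g) (fun i => Quotient.mk _ i)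
    (orb_mk_eq_iff g) Quotient.out Quotient.out_eq (fun q => (e q).out)
    (fun q q' hq => by
      rw [← orb_mk_eq_iff, Quotient.out_eq, Quotient.out_eq] at hq
      exact e.injective hq)
    (fun q => (congrArg Prod.fst (he q)).symm) (fun q => (congrArg Prod.snd (he q)).symm)
  exact ⟨h, hh⟩

/-- The element acting as `g` on the cycle through `i` and trivially elsewhere. -/
def rot (g : Hyper n) (i : Fin n) : Hyper n :=
  ⟨fun j => if g.right.SameCycle i j then g.left j else 1, g.right.cycleOf i⟩

theorem rot_comm (g : Hyper n) (i : Fin n) : rot g i * g = g * rot g i := by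
  refine SemidirectProduct.ext (funext fun x => ?_) (Equiv.ext fun x => ?_)
  · rw [mul_left_apply, mul_left_apply]
    simp only [rot, cycleOf_inv, cycleOf_apply, sameCycle_inv]
    simp only [Equiv.Perm.inv_def, sameCycle_symm_apply_right]
    split_ifs <;> simp
  · simp only [SemidirectProduct.mul_right, Equiv.Perm.mul_apply, rot, cycleOf_apply,
      sameCycle_apply_right]
    split_ifs <;> rfl

theorem rot_prod (g : Hyper n) (i : Fin n) : ∏ j, (rot g i).left j = cycSign g i := by
  rw [cycSign, Finset.prod_filter]
  rfl

theorem sign_rot (g : Hyper n) (i : Fin n) (h : Even (cycLen g i)) :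
    sign (rot g i).right = -1 := by
  have hi : g.right i ≠ i := by
    intro hi
    have h1 : (cycLen g i : ℤ) ∣ 1 := by
      rw [← zpow_apply_eq_iff, zpow_one, hi]
    have h2 : cycLen g i = 1 := by
      have := Int.le_of_dvd one_pos h1
      have := cycLen_pos g i
      omega
    rw [h2] at h
    exact absurd h (by decide)
  have hsupp : (g.right.cycleOf i).support =
      Finset.univ.filter fun j => g.right.SameCycle i j := by
    ext j
    rw [mem_support_cycleOf_iff, Finset.mem_filter_univ, and_iff_left (mem_support.2 hi)]
  change sign (g.right.cycleOf i) = -1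
  rw [(isCycle_cycleOf g.right hi).sign, hsupp]
  exact congrArg _ h.neg_one_pow

/-- The element changing all signs on the cycle through `i`. -/
def negOn (g : Hyper n) (i : Fin n) : Hyper n :=
  ⟨fun j => if g.right.SameCycle i j then Sgn.neg else 1, 1⟩

theorem negOn_comm (g : Hyper n) (i : Fin n) : negOn g i * g = g * negOn g i := by
  refine SemidirectProduct.ext (funext fun x => ?_) rfl
  rw [mul_left_apply, mul_left_apply]
  simp only [negOn, inv_one, Equiv.Perm.one_apply, Equiv.Perm.inv_def, sameCycle_symm_apply_right]
  rw [mul_comm]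

theorem negOn_prod (g : Hyper n) (i : Fin n) :
    ∏ j, (negOn g i).left j = Sgn.neg ^ cycLen g i := by
  rw [cycLen, ← Finset.prod_const, Finset.prod_filter]
  rfl

theorem exists_swap (g : Hyper n) {i j : Fin n} (hij : ¬ g.right.SameCycle i j)
    (hlen : cycLen g i = cycLen g j) (hsign : cycSign g i = cycSign g j) :
    ∃ h : Hyper n, h * g = g * h ∧ ∏ x, h.left x = 1 ∧ sign h.right = (-1) ^ cycLen g i := by
  classical
  let mk : Fin n → Orb g := fun i => Quotient.mk _ i
  let φ : Equiv.Perm (Orb g) := Equiv.swap (mk i) (mk j)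
  have hlen' : ∀ q : Orb g, cycLen g q.out = cycLen g (φ q).out ∧
      cycSign g q.out = cycSign g (φ q).out := by
    intro q
    have hi := sameCycle_out g i
    have hj := sameCycle_out g j
    simp only [φ]
    by_cases h1 : q = mk i
    · subst h1
      rw [Equiv.swap_apply_left, cycLen_congr hi, cycLen_congr hj, cycSign_congr hi,
        cycSign_congr hj]
      exact ⟨hlen, hsign⟩
    by_cases h2 : q = mk j
    · subst h2
      rw [Equiv.swap_apply_right, cycLen_congr hi, cycLen_congr hj, cycSign_congr hi,
        cycSign_congr hj]
      exact ⟨hlen.symm, hsign.symm⟩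
    rw [Equiv.swap_apply_of_ne_of_ne h1 h2]
    exact ⟨rfl, rfl⟩
  obtain ⟨h, hcomm, hright, hleft⟩ := exists_conj (g := g) (g' := g) (Q := Orb g) mk
    (orb_mk_eq_iff g) Quotient.out Quotient.out_eq (fun q => (φ q).out)
    (fun q q' hq => by
      rw [← orb_mk_eq_iff, Quotient.out_eq, Quotient.out_eq] at hq
      exact φ.injective hq)
    (fun q => (hlen' q).1) (fun q => (hlen' q).2)
  have hφ : ∀ q, φ (φ q) = q := fun q => Equiv.swap_apply_self _ _ q
  have hx : ∀ x, ∃ q : Orb g, ∃ k : ℤ, mk x = q ∧ (g.right ^ k) q.out = x := fun x => by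
    obtain ⟨k, hk⟩ := sameCycle_out g x
    exact ⟨mk x, k, rfl, hk⟩
  have hinv : ∀ x, h.right (h.right x) = x := by
    intro x
    obtain ⟨q, k, -, rfl⟩ := hx x
    rw [hright, hright, hφ]
  have hmk : ∀ x, mk (h.right x) = φ (mk x) := by
    intro x
    obtain ⟨q, k, hq, rfl⟩ := hx x
    rw [hright, hq]
    conv_rhs => rw [← Quotient.out_eq (φ q)]
    exact (orb_mk_eq_iff g _ _).2 (SameCycle.symm ⟨k, rfl⟩)
  have hfixed : ∀ x, φ (mk x) = mk x → h.right x = x := by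
    intro x hxφ
    obtain ⟨q, k, hq, rfl⟩ := hx x
    rw [hright, ← hq, hxφ]
  have hleft' : ∀ x, h.left (h.right x) = h.left x := by
    intro x
    obtain ⟨q, k, -, rfl⟩ := hx x
    have h1 := hleft (φ q) k
    simp only [hφ] at h1
    rw [hright, hleft, h1, mul_comm]
  have hleft1 : ∀ x, h.right x = x → h.left x = 1 := by
    intro x hxx
    obtain ⟨q, k, -, rfl⟩ := hx x
    have h1 := hleft q k
    rw [← hright, hxx] at h1
    rw [h1, Sgn.mul_self]
  refine ⟨h, hcomm, ?_, ?_⟩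
  · refine Finset.prod_involution (fun x _ => h.right x) (fun x _ => ?_) (fun x _ hne heq => ?_)
      (fun _ _ => Finset.mem_univ _) (fun x _ => hinv x)
    · rw [hleft', Sgn.mul_self]
    · exact hne (hleft1 x heq)
  · have hsq : h.right ^ 2 = 1 := Equiv.ext fun x => by
      rw [pow_two, Equiv.Perm.mul_apply, hinv]; rfl
    have hne : mk i ≠ mk j := fun e => hij ((orb_mk_eq_iff g i j).1 e)
    have hsupp : h.right.support = (Finset.univ.filter fun x => g.right.SameCycle i x) ∪
        Finset.univ.filter fun x => g.right.SameCycle j x := by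
      ext x
      rw [Finset.mem_union, Finset.mem_filter_univ, Finset.mem_filter_univ, mem_support,
        ← orb_mk_eq_iff, ← orb_mk_eq_iff]
      change _ ↔ mk i = mk x ∨ mk j = mk x
      constructor
      · intro hne'
        by_contra hcon
        rw [not_or] at hcon
        exact hne' (hfixed x (Equiv.swap_apply_of_ne_of_ne (Ne.symm hcon.1) (Ne.symm hcon.2)))
      · intro hor heq
        have h1 := hmk x
        rw [heq] at h1
        rcases hor with h2 | h2
        · rw [← h2] at h1
          simp only [φ, Equiv.swap_apply_left] at h1
          exact hne h1
        · rw [← h2] at h1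
          simp only [φ, Equiv.swap_apply_right] at h1
          exact hne h1.symm
    have hdisj : Disjoint (Finset.univ.filter fun x => g.right.SameCycle i x)
        (Finset.univ.filter fun x => g.right.SameCycle j x) := by
      rw [Finset.disjoint_left]
      intro x h1 h2
      rw [Finset.mem_filter_univ] at h1 h2
      exact hij (h1.trans h2.symm)
    have hcard : h.right.support.card = 2 * cycLen g i := by
      rw [hsupp, Finset.card_union_of_disjoint hdisj, two_mul]
      conv_rhs => rw [hlen]
      conv_rhs => arg 1; rw [← hlen]
      rfl
    have hle := Finset.card_le_univ h.right.support
    rw [sign_of_pow_two_eq_one hsq, card_fixedPoints, sum_cycleType]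
    congr 1
    omega

/-- Every even-signed element commuting with `g` is an even permutation. -/
def SignTrivial (g : Hyper n) : Prop :=
  ∀ c : Hyper n, c * g = g * c → ∏ i, c.left i = 1 → sign c.right = 1

/-- All cycles are odd and pairwise distinguished by length and sign. -/
def OddDistinct (g : Hyper n) : Prop :=
  (∀ i, Odd (cycLen g i)) ∧
    ∀ i j, cycLen g i = cycLen g j → cycSign g i = cycSign g j → g.right.SameCycle i j

/-- All cycles are even and negative. -/
def EvenNegative (g : Hyper n) : Prop :=
  ∀ i, Even (cycLen g i) ∧ cycSign g i = Sgn.neg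

theorem prod_mul_left (a b : Hyper n) :
    ∏ i, (a * b).left i = (∏ i, a.left i) * ∏ i, b.left i := by
  rw [← Equiv.prod_comp a.right⁻¹ b.left, ← Finset.prod_mul_distrib]
  rfl

theorem SignTrivial.oddDistinct_or_evenNegative {g : Hyper n} (hg : SignTrivial g) :
    OddDistinct g ∨ EvenNegative g := by
  by_cases hodd : ∀ i, Odd (cycLen g i)
  · refine Or.inl ⟨hodd, fun i j hl hs => ?_⟩
    by_contra hij
    obtain ⟨h, hc, hp, hsgn⟩ := exists_swap g hij hl hs
    rw [hg h hc hp, (hodd i).neg_one_pow] at hsgn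
    exact absurd hsgn (by decide)
  · right
    push Not at hodd
    obtain ⟨i₀, hi₀⟩ := hodd
    rw [Nat.not_odd_iff_even] at hi₀
    have hneg : ∀ i, Even (cycLen g i) → cycSign g i = Sgn.neg := by
      intro i hi
      refine (Sgn.eq_one_or _).resolve_left fun h1 => ?_
      have := hg (rot g i) (rot_comm g i) (by rw [rot_prod, h1])
      rw [sign_rot g i hi] at this
      exact absurd this (by decide)
    have heven : ∀ i, Even (cycLen g i) := by
      intro i
      by_contra hi
      have := hg (negOn g i * rot g i₀)
        (by rw [mul_assoc, rot_comm, ← mul_assoc, negOn_comm, mul_assoc])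
        (by
          rcases Sgn.eq_one_or (Sgn.neg ^ cycLen g i) with h | h
          · exact absurd ((Sgn.neg_pow_eq_one_iff _).1 h) hi
          · rw [prod_mul_left, negOn_prod, rot_prod, h, hneg i₀ hi₀, Sgn.mul_self])
      rw [SemidirectProduct.mul_right, Equiv.Perm.sign_mul, sign_rot g i₀ hi₀] at this
      simp [negOn] at this
    exact fun i => ⟨heven i, hneg i (heven i)⟩

theorem OddDistinct.signTrivial {g : Hyper n} (hg : OddDistinct g) : SignTrivial g := by
  intro c hc _
  have hcomm : c.right * g.right = g.right * c.right := congrArg SemidirectProduct.right hc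
  have hN : c.right ^ (∏ i, cycLen g i) = 1 := by
    refine Equiv.ext fun i => ?_
    obtain ⟨a, ha⟩ := hg.2 i (c.right i) (cycLen_map hc i).symm (cycSign_map hc i).symm
    have key : ∀ k : ℕ, (c.right ^ k) i = (g.right ^ (a * k)) i := by
      intro k
      induction k with
      | zero => simp
      | succ k ih =>
        have hz : c.right * g.right ^ (a * k : ℤ) = g.right ^ (a * k : ℤ) * c.right :=
          (Commute.zpow_right hcomm _)
        have := congrArg (fun τ : Equiv.Perm (Fin n) => τ i) hz
        simp only [Equiv.Perm.mul_apply] at this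
        rw [pow_succ', Equiv.Perm.mul_apply, ih, this, ← ha, ← Equiv.Perm.mul_apply, ← zpow_add]
        congr 2
        push_cast
        ring
    rw [key, Equiv.Perm.one_apply, zpow_apply_eq_iff]
    refine Dvd.dvd.mul_left ?_ a
    exact_mod_cast Finset.dvd_prod_of_mem (cycLen g) (Finset.mem_univ i)
  have hodd : Odd (∏ i, cycLen g i) :=
    Finset.prod_induction _ Odd (fun _ _ => Odd.mul) odd_one fun i _ => hg.1 i
  have h1 : sign c.right ^ (∏ i, cycLen g i) = 1 := by rw [← map_pow, hN, map_one]
  rcases Int.units_eq_one_or (sign c.right) with h | h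
  · exact h
  · rw [h, hodd.neg_one_pow] at h1
    exact absurd h1 (by decide)

theorem det_nonneg_of_commute {V : Type*} [AddCommGroup V] [Module ℝ V]
    (J f : Module.End ℝ V) (hJ : J * J = -1) (hf : f * J = J * f) : 0 ≤ LinearMap.det f := by
  let F : ℂ →ₐ[ℝ] Module.End ℝ V := Complex.lift ⟨J, hJ⟩
  let : Module ℂ V := Module.compHom V F.toRingHom
  have hsmul : ∀ (z : ℂ) (v : V), z • v = F z v := fun _ _ => rfl
  have hF : ∀ z : ℂ, F z = algebraMap ℝ _ z.re + z.im • J := fun z => by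
    simp [F, Complex.lift_apply, Complex.liftAux_apply]
  have : IsScalarTower ℝ ℂ V := ⟨fun r z v => by
    rw [hsmul, hsmul, map_smul]; rfl⟩
  let f' : V →ₗ[ℂ] V :=
    { toFun := f
      map_add' := map_add f
      map_smul' := fun z v => by
        have h := congrArg (fun φ : Module.End ℝ V => φ v) hf
        simp only [Module.End.mul_apply] at h
        simp [hsmul, hF, h, Module.algebraMap_end_apply] }
  have h : LinearMap.det (f'.restrictScalars ℝ) = Algebra.norm ℝ (LinearMap.det f') :=
    LinearMap.det_restrictScalars
  have h2 : f'.restrictScalars ℝ = f := rfl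
  rw [← h2, h, Algebra.norm_complex_apply]
  exact Complex.normSq_nonneg _

/-- The sign as a real number. -/
def Sgn.toReal : Sgn →* ℝ where
  toFun z := if z = 1 then 1 else -1
  map_one' := by simp
  map_mul' a b := by
    rcases Sgn.eq_one_or a with rfl | rfl <;> rcases Sgn.eq_one_or b with rfl | rfl <;>
      simp [Sgn.mul_self, Sgn.neg_ne_one]

/-- The reflection representation on `ℝⁿ` by signed permutation matrices. -/
def signedRep (g : Hyper n) : Module.End ℝ (Fin n → ℝ) where
  toFun f i := Sgn.toReal (g.left i) * f (g.right⁻¹ i)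
  map_add' f f' := by ext i; simp [mul_add]
  map_smul' r f := by ext i; simp [mul_left_comm]

theorem signedRep_apply (g : Hyper n) (f : Fin n → ℝ) (i : Fin n) :
    signedRep g f i = Sgn.toReal (g.left i) * f (g.right⁻¹ i) := rfl

theorem signedRep_mul (a b : Hyper n) : signedRep (a * b) = signedRep a * signedRep b := by
  refine LinearMap.ext fun f => funext fun i => ?_
  rw [Module.End.mul_apply]
  simp only [signedRep_apply, mul_left_apply, SemidirectProduct.mul_right, mul_inv_rev, map_mul,
    mul_assoc, Equiv.Perm.mul_apply]

theorem det_signedRep (g : Hyper n) :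
    LinearMap.det (signedRep g) = Sgn.toReal (∏ i, g.left i) * (sign g.right : ℤ) := by
  have : signedRep g = Matrix.toLin'
      (Matrix.diagonal (fun i => Sgn.toReal (g.left i)) * (g.right⁻¹).permMatrix ℝ) := by
    refine LinearMap.ext fun f => funext fun i => ?_
    rw [Matrix.toLin'_apply, ← Matrix.mulVec_mulVec, Matrix.mulVec_diagonal, signedRep_apply,
      Matrix.permMatrix_mulVec]
    rfl
  rw [this, LinearMap.det_toLin', Matrix.det_mul, Matrix.det_diagonal, Matrix.det_permutation,
    map_prod, Equiv.Perm.sign_inv]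

theorem cycLen_zpow_apply (g : Hyper n) (k : ℤ) (i : Fin n) :
    cycLen g ((g.right ^ k) i) = cycLen g i :=
  (cycLen_congr ⟨k, rfl⟩).symm

theorem EvenNegative.signTrivial {g : Hyper n} (hg : EvenNegative g) : SignTrivial g := by
  intro c hc hp
  let J : Module.End ℝ (Fin n → ℝ) :=
    { toFun := fun f i => signedRep (g ^ (cycLen g i / 2)) f i
      map_add' := fun f f' => by ext i; simp
      map_smul' := fun r f => by ext i; simp }
  have hJapp : ∀ f i, J f i = signedRep (g ^ (cycLen g i / 2)) f i := fun _ _ => rfl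
  have hJ : J * J = -1 := by
    refine LinearMap.ext fun f => funext fun i => ?_
    have h1 : J f ((g ^ (cycLen g i / 2)).right⁻¹ i) =
        signedRep (g ^ (cycLen g i / 2)) f ((g ^ (cycLen g i / 2)).right⁻¹ i) := by
      have hl : cycLen g ((g ^ (cycLen g i / 2)).right⁻¹ i) = cycLen g i := by
        rw [pow_right, ← zpow_natCast, ← zpow_neg, cycLen_zpow_apply]
      rw [hJapp, hl]
    have h2 : g ^ (cycLen g i / 2) * g ^ (cycLen g i / 2) = g ^ cycLen g i := by
      rw [← pow_add]
      congr 1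
      obtain ⟨r, hr⟩ := (hg i).1
      omega
    have h3 : (g.right ^ cycLen g i)⁻¹ i = i := by
      rw [Equiv.Perm.inv_eq_iff_eq, pow_cycLen_apply]
    rw [Module.End.mul_apply, hJapp, signedRep_apply, h1, ← signedRep_apply,
      ← Module.End.mul_apply, ← signedRep_mul, h2, signedRep_apply, pow_cycLen_left, (hg i).2,
      pow_right, h3]
    simp [Sgn.toReal, Sgn.neg_ne_one]
  have hcJ : signedRep c * J = J * signedRep c := by
    refine LinearMap.ext fun f => funext fun i => ?_
    have hlen : cycLen g (c.right⁻¹ i) = cycLen g i := by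
      rw [← cycLen_map hc]; simp
    have hck : c * g ^ (cycLen g i / 2) = g ^ (cycLen g i / 2) * c := Commute.pow_right hc _
    rw [Module.End.mul_apply, Module.End.mul_apply, signedRep_apply, hJapp, hJapp, hlen,
      ← signedRep_apply, ← Module.End.mul_apply, ← Module.End.mul_apply, ← signedRep_mul,
      ← signedRep_mul, hck]
  have h := det_nonneg_of_commute J (signedRep c) hJ hcJ
  rw [det_signedRep, hp, map_one, one_mul] at h
  rcases Int.units_eq_one_or (sign c.right) with h1 | h1
  · exact h1
  · rw [h1] at h
    norm_num at h

theorem exists_comm_prod_ne_one [NeZero n] {g : Hyper n} (hg : OddDistinct g ∨ EvenNegative g) :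
    ∃ c : Hyper n, c * g = g * c ∧ ∏ i, c.left i = Sgn.neg := by
  rcases hg with hg | hg
  · refine ⟨negOn g 0, negOn_comm g 0, ?_⟩
    rw [negOn_prod]
    refine (Sgn.eq_one_or _).resolve_left fun h => ?_
    rw [Sgn.neg_pow_eq_one_iff] at h
    exact Nat.not_even_iff_odd.2 (hg.1 0) h
  · exact ⟨rot g 0, rot_comm g 0, by rw [rot_prod, (hg 0).2]⟩

/-- Conjugators of sign-trivial elements can be chosen with even signs. -/
theorem exists_even_conj [NeZero n] {g g' : Hyper n} (hg : OddDistinct g ∨ EvenNegative g)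
    (h : cycType g = cycType g') :
    ∃ w : Hyper n, ∏ i, w.left i = 1 ∧ w * g = g' * w := by
  obtain ⟨w, hw⟩ := exists_conj_of_cycType_eq h
  obtain ⟨c, hc, hcp⟩ := exists_comm_prod_ne_one hg
  rcases Sgn.eq_one_or (∏ i, w.left i) with h1 | h1
  · exact ⟨w, h1, hw⟩
  · refine ⟨w * c, by rw [prod_mul_left, h1, hcp, Sgn.mul_self], ?_⟩
    rw [mul_assoc, hc, ← mul_assoc, hw, mul_assoc]

theorem exists_cycType_eq_map_univ {J : Type*} [Fintype J] (len : J → ℕ) (s : J → Sgn)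
    (hpos : ∀ j, 0 < len j) (hsum : ∑ j, len j = n) :
    ∃ g : Hyper n, cycType g = (Finset.univ : Finset J).val.map fun j => (len j, s j) := by
  classical
  have : ∀ j, NeZero (len j) := fun j => ⟨(hpos j).ne'⟩
  have hcard : Fintype.card (Σ j, ZMod (len j)) = n := by
    rw [Fintype.card_sigma, ← hsum]
    exact Finset.sum_congr rfl fun j _ => ZMod.card _
  let e : (Σ j, ZMod (len j)) ≃ Fin n := Fintype.equivFinOfCardEq hcard
  let σ₀ : Equiv.Perm (Σ j, ZMod (len j)) := Equiv.sigmaCongrRight fun j => Equiv.addRight 1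
  let σ : Equiv.Perm (Fin n) := e.permCongr σ₀
  let t : Fin n → Sgn := fun i => if (e.symm i).2 = 0 then s (e.symm i).1 else 1
  let g : Hyper n := ⟨t, σ⟩
  have hσ : ∀ x, σ (e x) = e (σ₀ x) := fun x => by simp [σ]
  have hpow : ∀ (k : ℕ) j (x : ZMod (len j)), (σ ^ k) (e ⟨j, x⟩) = e ⟨j, x + k⟩ := by
    intro k j x
    induction k with
    | zero => simp
    | succ k ih =>
      rw [pow_succ', Equiv.Perm.mul_apply, ih, hσ]
      simp [σ₀, add_assoc]
  have hsame : ∀ x y, σ.SameCycle (e x) (e y) ↔ x.1 = y.1 := by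
    rintro ⟨j, x⟩ ⟨j', y⟩
    constructor
    · intro h
      obtain ⟨k, hk⟩ := h.exists_nat_pow_eq
      have hk' : (σ ^ k) (e ⟨j, x⟩) = e ⟨j', y⟩ := hk
      rw [hpow] at hk'
      have h' := congrArg Sigma.fst (e.injective hk')
      exact h'
    · intro h
      simp only at h
      subst h
      refine ⟨((y - x).val : ℕ), ?_⟩
      rw [zpow_natCast, hpow, ZMod.natCast_zmod_val]
      simp
  have hprod : ∀ {A : Type} [CommMonoid A] (F : Fin n → A) x,
      ∏ i ∈ Finset.univ.filter (fun i => σ.SameCycle (e x) i), F i =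
        ∏ y : ZMod (len x.1), F (e ⟨x.1, y⟩) := by
    intro A _ F x
    symm
    refine Finset.prod_bij (fun y _ => e ⟨x.1, y⟩) (fun y _ => ?_) (fun y _ y' _ h => ?_)
      (fun i hi => ?_) (fun _ _ => rfl)
    · rw [Finset.mem_filter_univ, hsame]
    · simpa using e.injective h
    · rw [Finset.mem_filter_univ, ← e.apply_symm_apply i, hsame] at hi
      obtain ⟨⟨j, y⟩, hy⟩ : ∃ z, e.symm i = z := ⟨_, rfl⟩
      rw [hy] at hi
      simp only at hi
      subst hi
      exact ⟨y, Finset.mem_univ _, by rw [← hy, e.apply_symm_apply]⟩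
  have hlen : ∀ x, cycLen g (e x) = len x.1 := by
    intro x
    have h := hprod (A := Multiplicative ℕ) (fun _ => Multiplicative.ofAdd 1) x
    rw [Finset.prod_const, Finset.prod_const, Finset.card_univ, ZMod.card] at h
    have h' : (Finset.univ.filter fun i => σ.SameCycle (e x) i).card = len x.1 := by
      simpa using congrArg Multiplicative.toAdd h
    exact h'
  have hsign : ∀ x, cycSign g (e x) = s x.1 := by
    intro x
    refine (hprod t x).trans ?_
    rw [Finset.prod_eq_single (0 : ZMod (len x.1))]
    · exact (if_pos (by rw [e.symm_apply_apply])).trans (by rw [e.symm_apply_apply])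
    · exact fun y _ hy => if_neg (by rwa [e.symm_apply_apply])
    · exact fun h => (h (Finset.mem_univ _)).elim
  have hlift : ∀ i i', σ.SameCycle i i' → (e.symm i).1 = (e.symm i').1 := by
    intro i i' h
    rw [← hsame, e.apply_symm_apply, e.apply_symm_apply]
    exact h
  let E₀ : Orb g → J := Quotient.lift (fun i => (e.symm i).1) hlift
  have hE : Function.Bijective E₀ := by
    constructor
    · rintro ⟨i⟩ ⟨i'⟩ h
      refine (orb_mk_eq_iff g i i').2 ?_
      have h' : (e.symm i).1 = (e.symm i').1 := h
      rw [← hsame, e.apply_symm_apply, e.apply_symm_apply] at h'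
      exact h'
    · intro j
      exact ⟨Quotient.mk _ (e ⟨j, 0⟩), by
        change (e.symm (e ⟨j, 0⟩)).1 = j
        rw [e.symm_apply_apply]⟩
  refine ⟨g, ?_⟩
  rw [cycType, ← Multiset.map_univ_val_equiv (Equiv.ofBijective E₀ hE), Multiset.map_map]
  refine Multiset.map_congr (by congr!) fun q _ => ?_
  have hq : E₀ q = (e.symm q.out).1 := by
    conv_lhs => rw [← Quotient.out_eq q]
    rfl
  simp only [Function.comp_apply, Equiv.ofBijective_apply]
  rw [hq, ← hlen, ← hsign, e.apply_symm_apply]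

theorem exists_cycType_eq (M : Multiset (ℕ × Sgn)) (hpos : ∀ p ∈ M, 0 < p.1)
    (hsum : (M.map Prod.fst).sum = n) : ∃ g : Hyper n, cycType g = M := by
  classical
  obtain ⟨g, hg⟩ := exists_cycType_eq_map_univ (n := n) (J := M.ToType)
    (fun x => x.1.1) (fun x => x.1.2) (fun x => hpos _ (Multiset.coe_mem))
    (by
      rw [← hsum]
      conv_rhs => rw [← Multiset.map_univ_coe M, Multiset.map_map]
      rfl)
  exact ⟨g, hg.trans (Multiset.map_univ_coe M)⟩

theorem oddDistinct_iff (g : Hyper n) :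
    OddDistinct g ↔ (∀ p ∈ cycType g, Odd p.1) ∧ (cycType g).Nodup := by
  have hodd : (∀ p ∈ cycType g, Odd p.1) ↔ ∀ i, Odd (cycLen g i) := by
    constructor
    · exact fun h i => h _ ((mem_cycType g _).2 ⟨i, rfl⟩)
    · rintro h p hp
      obtain ⟨i, rfl⟩ := (mem_cycType g p).1 hp
      exact h i
  rw [OddDistinct, hodd]
  refine and_congr_right fun _ => ⟨fun h => ?_, fun h i j hl hs => ?_⟩
  · refine (Multiset.nodup_map_iff_inj_on Finset.univ.nodup).2 fun q _ q' _ hq => ?_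
    rw [← Quotient.out_eq q, ← Quotient.out_eq q']
    exact (orb_mk_eq_iff g _ _).2 (h _ _ (congrArg Prod.fst hq) (congrArg Prod.snd hq))
  · refine (orb_mk_eq_iff g i j).1 ?_
    refine (Multiset.nodup_map_iff_inj_on Finset.univ.nodup).1 h _ (Finset.mem_univ _) _
      (Finset.mem_univ _) ?_
    rw [cycLen_congr (sameCycle_out g i), cycSign_congr (sameCycle_out g i),
      cycLen_congr (sameCycle_out g j), cycSign_congr (sameCycle_out g j), hl, hs]

theorem evenNegative_iff (g : Hyper n) :
    EvenNegative g ↔ ∀ p ∈ cycType g, Even p.1 ∧ p.2 = Sgn.neg := by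
  constructor
  · rintro h p hp
    obtain ⟨i, rfl⟩ := (mem_cycType g p).1 hp
    exact h i
  · exact fun h i => h _ ((mem_cycType g _).2 ⟨i, rfl⟩)

end Hyper

section Isotypic

variable {k W : Type*} [Field k] [Group W]

theorem adConj_coeff (w : W) (f : MonoidAlgebra k W) (x : W) :
    (adConj k w f).coeff x = f.coeff (w⁻¹ * x * w) := by
  have h : adConj k w f = MonoidAlgebra.single w 1 * f * MonoidAlgebra.single w⁻¹ 1 := rfl
  rw [h, MonoidAlgebra.coeff_mul_single_apply, MonoidAlgebra.coeff_single_mul_apply]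
  simp [mul_assoc]

theorem mem_signIsotypic_iff (ε : W → k) (f : MonoidAlgebra k W) :
    f ∈ signIsotypic k W ε ↔ ∀ w x, f.coeff (w * x * w⁻¹) = ε w⁻¹ * f.coeff x := by
  have h1 : f ∈ signIsotypic k W ε ↔ ∀ w, adConj k w f = ε w • f := by
    simp [signIsotypic, Submodule.mem_iInf, LinearMap.mem_eqLocus]
  rw [h1, ← (Equiv.inv W).forall_congr_right]
  refine forall_congr' fun w => ?_
  rw [← MonoidAlgebra.coeff_injective.eq_iff, Finsupp.ext_iff]
  simp [adConj_coeff]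

theorem finrank_signIsotypic [Finite W] (ε : W →* kˣ) {ι : Type*} [Finite ι] (r : ι → W)
    (htriv : ∀ i w, w * r i = r i * w → ε w = 1)
    (hinj : ∀ i j w, w * r i * w⁻¹ = r j → i = j)
    (hsurj : ∀ x, (∀ w, w * x = x * w → ε w = 1) → ∃ i w, w * r i * w⁻¹ = x) :
    Module.finrank k (signIsotypic k W fun w => (ε w : k)) = Nat.card ι := by
  classical
  have := Fintype.ofFinite ι
  have hvanish : ∀ f ∈ signIsotypic k W fun w => (ε w : k), ∀ x,
      (∀ i w, w * r i * w⁻¹ ≠ x) → f.coeff x = 0 := by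
    intro f hf x hx
    rw [mem_signIsotypic_iff] at hf
    obtain ⟨w, hw, hε⟩ : ∃ w, w * x = x * w ∧ ε w ≠ 1 := by
      by_contra! h
      obtain ⟨i, w, hi⟩ := hsurj x h
      exact hx i w hi
    have h := hf w⁻¹ x
    rw [inv_inv, mul_assoc, ← hw, inv_mul_cancel_left] at h
    have h' : ((ε w : k) - 1) * f.coeff x = 0 := by rw [sub_mul, ← h]; ring
    refine (mul_eq_zero.1 h').resolve_left fun h0 => hε ?_
    exact Units.ext (by simpa using sub_eq_zero.1 h0)
  let L : signIsotypic k W (fun w => (ε w : k)) →ₗ[k] ι → k :=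
    { toFun := fun f i => f.1.coeff (r i)
      map_add' := fun f g => by ext i; simp
      map_smul' := fun c f => by ext i; simp }
  have hL : Function.Bijective L := by
    constructor
    · intro f g hfg
      refine Subtype.ext (MonoidAlgebra.coeff_injective (Finsupp.ext fun x => ?_))
      by_cases hx : ∃ i w, w * r i * w⁻¹ = x
      · obtain ⟨i, w, rfl⟩ := hx
        have h : f.1.coeff (r i) = g.1.coeff (r i) := congrFun hfg i
        rw [(mem_signIsotypic_iff _ _).1 f.2, (mem_signIsotypic_iff _ _).1 g.2, h]
      · push Not at hx
        rw [hvanish _ f.2 x hx, hvanish _ g.2 x hx]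
    · intro v
      let F : W → k := fun x =>
        if h : ∃ p : ι × W, p.2 * r p.1 * p.2⁻¹ = x then
          (ε h.choose.2⁻¹ : k) * v h.choose.1 else 0
      have hF : ∀ i w, F (w * r i * w⁻¹) = (ε w⁻¹ : k) * v i := by
        intro i w
        have h : ∃ p : ι × W, p.2 * r p.1 * p.2⁻¹ = w * r i * w⁻¹ := ⟨(i, w), rfl⟩
        have hc := h.choose_spec
        have hFe : F (w * r i * w⁻¹) = (ε h.choose.2⁻¹ : k) * v h.choose.1 := dif_pos h
        rw [hFe]
        generalize h.choose = p at hc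
        obtain ⟨j, u⟩ := p
        simp only at hc ⊢
        obtain rfl : j = i := hinj j i (w⁻¹ * u) (by
          rw [mul_inv_rev, inv_inv]
          calc w⁻¹ * u * r j * (u⁻¹ * w) = w⁻¹ * (u * r j * u⁻¹) * w := by group
            _ = r i := by rw [hc]; group)
        have h1 := htriv j (w⁻¹ * u) (by
          calc w⁻¹ * u * r j = w⁻¹ * (u * r j * u⁻¹) * u := by group
            _ = r j * (w⁻¹ * u) := by rw [hc]; group)
        rw [map_mul, map_inv, inv_mul_eq_one] at h1
        rw [map_inv, map_inv, h1]
      have hF0 : ∀ x, (¬ ∃ p : ι × W, p.2 * r p.1 * p.2⁻¹ = x) → F x = 0 :=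
        fun x h => dif_neg h
      refine ⟨⟨MonoidAlgebra.ofCoeff (Finsupp.equivFunOnFinite.symm F),
        (mem_signIsotypic_iff _ _).2 fun w x => ?_⟩, ?_⟩
      · change F (w * x * w⁻¹) = _ * F x
        by_cases hx : ∃ p : ι × W, p.2 * r p.1 * p.2⁻¹ = x
        · obtain ⟨⟨i, u⟩, rfl⟩ := hx
          have h : w * (u * r i * u⁻¹) * w⁻¹ = (w * u) * r i * (w * u)⁻¹ := by group
          simp only
          rw [h, hF, hF, mul_inv_rev, map_mul, Units.val_mul]
          ring
        · rw [hF0 x hx, hF0, mul_zero]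
          rintro ⟨⟨i, u⟩, hu⟩
          refine hx ⟨(i, w⁻¹ * u), ?_⟩
          simp only at hu ⊢
          calc w⁻¹ * u * r i * (w⁻¹ * u)⁻¹ = w⁻¹ * (u * r i * u⁻¹) * w := by group
            _ = x := by rw [hu]; group
      · ext i
        change F (r i) = v i
        simpa using hF i 1
  rw [(LinearEquiv.ofBijective L hL).finrank_eq, Module.finrank_fintype_fun_eq_card,
    Nat.card_eq_fintype_card]

end Isotypic

namespace Hyper

open Equiv.Perm

variable {n : ℕ}

/-- The signed cycle type with positive parts `p.1` and negative parts `p.2`. -/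
def signedType (p : Multiset ℕ × Multiset ℕ) : Multiset (ℕ × Sgn) :=
  p.1.map (·, 1) + p.2.map (·, Sgn.neg)

theorem mem_signedType {p : Multiset ℕ × Multiset ℕ} {x : ℕ × Sgn} :
    x ∈ signedType p ↔ (x.1 ∈ p.1 ∧ x.2 = 1) ∨ (x.1 ∈ p.2 ∧ x.2 = Sgn.neg) := by
  obtain ⟨l, s⟩ := x
  simp only [signedType, Multiset.mem_add, Multiset.mem_map, Prod.mk.injEq]
  grind

theorem signedType_map_fst_sum (p : Multiset ℕ × Multiset ℕ) :
    ((signedType p).map Prod.fst).sum = p.1.sum + p.2.sum := by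
  simp [signedType, Multiset.map_map]

theorem signedType_map_snd_prod (p : Multiset ℕ × Multiset ℕ) :
    ((signedType p).map Prod.snd).prod = Sgn.neg ^ Multiset.card p.2 := by
  simp [signedType, Multiset.map_map]

theorem signedType_bijective : Function.Bijective signedType := by
  have h1 : Sgn.neg ≠ 1 := Sgn.neg_ne_one
  refine Function.bijective_iff_has_inverse.2
    ⟨fun M => ((M.filter fun x => x.2 = 1).map Prod.fst,
      (M.filter fun x => x.2 = Sgn.neg).map Prod.fst), fun p => ?_, fun M => ?_⟩
  · ext1 <;>
      simp [signedType, Multiset.filter_map, Multiset.map_map, h1, h1.symm]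
  · simp only [signedType, Multiset.map_map]
    have hm : ∀ s : Sgn, (M.filter fun x => x.2 = s).map ((·, s) ∘ Prod.fst) =
        M.filter fun x => x.2 = s := by
      intro s
      conv_rhs => rw [← Multiset.map_id (M.filter fun x => x.2 = s)]
      refine Multiset.map_congr rfl fun x hx => ?_
      exact Prod.ext rfl (Multiset.mem_filter.1 hx).2.symm
    rw [hm, hm]
    have h2 : (M.filter fun x => x.2 = Sgn.neg) = M.filter fun x => ¬ x.2 = 1 :=
      Multiset.filter_congr fun x _ =>
        ⟨fun h => by rw [h]; exact h1, (Sgn.eq_one_or x.2).resolve_left⟩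
    rw [h2, Multiset.filter_add_not]

theorem nodup_signedType (p : Multiset ℕ × Multiset ℕ) :
    (signedType p).Nodup ↔ p.1.Nodup ∧ p.2.Nodup := by
  have hi : ∀ s : Sgn, Function.Injective fun l : ℕ => (l, s) :=
    fun s a b h => congrArg Prod.fst h
  rw [signedType, Multiset.nodup_add, Multiset.nodup_map_iff_of_injective (hi _),
    Multiset.nodup_map_iff_of_injective (hi _)]
  refine ⟨fun h => ⟨h.1, h.2.1⟩, fun h => ⟨h.1, h.2, ?_⟩⟩
  rw [Multiset.disjoint_left]
  rintro x hx hx'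
  obtain ⟨a, _, rfl⟩ := Multiset.mem_map.1 hx
  obtain ⟨b, _, hb⟩ := Multiset.mem_map.1 hx'
  exact Sgn.neg_ne_one (congrArg Prod.snd hb)

/-- Pairs of sets of odd numbers with total sum `n`, the second one of even cardinality. -/
def oddLabels (n : ℕ) : Set (Multiset ℕ × Multiset ℕ) :=
  {p | p.1.sum + p.2.sum = n ∧ Even (Multiset.card p.2) ∧
    ((∀ x ∈ p.1, Odd x) ∧ p.1.Nodup) ∧ ((∀ x ∈ p.2, Odd x) ∧ p.2.Nodup)}

/-- Pairs of the empty multiset with an even number of positive even numbers of sum `n`. -/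
def evenLabels (n : ℕ) : Set (Multiset ℕ × Multiset ℕ) :=
  {p | p.1 = 0 ∧ p.2.sum = n ∧ Even (Multiset.card p.2) ∧ ∀ x ∈ p.2, Even x ∧ 0 < x}

theorem disjoint_labels [NeZero n] : Disjoint (oddLabels n) (evenLabels n) := by
  rw [Set.disjoint_left]
  rintro ⟨a, b⟩ ⟨-, -, -, hb, -⟩ ⟨-, hs, -, hb'⟩
  simp only at hb hs hb'
  have hb0 : b = 0 := Multiset.eq_zero_of_forall_notMem fun x hx =>
    Nat.not_even_iff_odd.2 (hb x hx) (hb' x hx).1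
  rw [hb0, Multiset.sum_zero] at hs
  exact NeZero.ne n hs.symm

theorem card_oddLabels (n : ℕ) :
    Nat.card {x : Σ m : ℕ, Nat.Partition m × Nat.Partition (n - m) //
        x.1 ≤ n ∧ DistinctOddParts x.2.1 ∧ DistinctOddParts x.2.2 ∧
        Even (Multiset.card x.2.2.parts)} = Nat.card (oddLabels n) := by
  refine Nat.card_congr (Equiv.ofBijective (fun x => ⟨(x.1.2.1.parts, x.1.2.2.parts), ?_⟩)
    ⟨?_, ?_⟩)
  · obtain ⟨⟨m, lam, mu⟩, hm, h1, h2, h3⟩ := x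
    refine ⟨?_, h3, h1, h2⟩
    simp only at hm ⊢
    rw [lam.parts_sum, mu.parts_sum]
    omega
  · rintro ⟨⟨m, lam, mu⟩, hx⟩ ⟨⟨m', lam', mu'⟩, hx'⟩ h
    simp only [Subtype.mk.injEq, Prod.mk.injEq] at h
    obtain rfl : m = m' := by rw [← lam.parts_sum, ← lam'.parts_sum, h.1]
    obtain rfl : lam = lam' := Nat.Partition.ext h.1
    obtain rfl : mu = mu' := Nat.Partition.ext h.2
    rfl
  · rintro ⟨⟨a, b⟩, hs, h3, h1, h2⟩
    simp only at hs h3 h1 h2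
    exact ⟨⟨⟨a.sum, ⟨a, fun {x} hx => (h1.1 x hx).pos, rfl⟩,
      ⟨b, fun {x} hx => (h2.1 x hx).pos, by omega⟩⟩, by simp only; omega, h1, h2, h3⟩, rfl⟩

theorem sum_map_two_mul (s : Multiset ℕ) : (s.map (2 * ·)).sum = 2 * s.sum := by
  simpa using Multiset.sum_map_mul_left (s := s) (a := 2) (f := id)

theorem card_evenLabels (n : ℕ) :
    (if Even n then
      Nat.card {nu : Nat.Partition (n / 2) // Even (Multiset.card nu.parts)} else 0) =
      Nat.card (evenLabels n) := by
  split_ifs with hn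
  · refine Nat.card_congr (Equiv.ofBijective (fun x => ⟨(0, x.1.parts.map (2 * ·)), ?_⟩)
      ⟨?_, ?_⟩)
    · refine ⟨rfl, ?_, ?_, ?_⟩
      · rw [sum_map_two_mul, x.1.parts_sum, Nat.two_mul_div_two_of_even hn]
      · simpa using x.2
      · intro y hy
        obtain ⟨z, hz, rfl⟩ := Multiset.mem_map.1 hy
        have := x.1.parts_pos hz
        exact ⟨even_two_mul z, by omega⟩
    · rintro ⟨x, hx⟩ ⟨y, hy⟩ h
      exact Subtype.ext (Nat.Partition.ext (Multiset.map_injective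
        (mul_right_injective₀ two_ne_zero) (congrArg (fun p => p.1.2) h)))
    · rintro ⟨⟨a, b⟩, ha, hs, hc, hb⟩
      simp only at ha hs hc hb
      subst ha
      have hb2 : (b.map (· / 2)).map (2 * ·) = b := by
        rw [Multiset.map_map]
        conv_rhs => rw [← Multiset.map_id b]
        exact Multiset.map_congr rfl fun x hx => Nat.two_mul_div_two_of_even (hb x hx).1
      refine ⟨⟨⟨b.map (· / 2), ?_, ?_⟩, by simpa using hc⟩, ?_⟩
      · intro x hx
        obtain ⟨z, hz, rfl⟩ := Multiset.mem_map.1 hx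
        obtain ⟨⟨c, rfl⟩, hpos⟩ := hb z hz
        omega
      · have h := congrArg Multiset.sum hb2
        rw [sum_map_two_mul] at h
        omega
      · exact Subtype.ext (Prod.ext rfl hb2)
  · have : IsEmpty (evenLabels n) := by
      refine ⟨fun ⟨p, _, hs, _, hp⟩ => hn ?_⟩
      rw [← hs]
      exact even_iff_two_dvd.2 (Multiset.dvd_sum fun x hx => even_iff_two_dvd.1 (hp x hx).1)
    rw [Nat.card_of_isEmpty]

theorem signedType_cases {p : Multiset ℕ × Multiset ℕ} {g : Hyper n}
    (h : cycType g = signedType p) (hg : ∏ i, g.left i = 1) :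
    (p ∈ oddLabels n ↔ OddDistinct g) ∧ (p ∈ evenLabels n ↔ EvenNegative g) := by
  have hsum : p.1.sum + p.2.sum = n := by
    rw [← signedType_map_fst_sum, ← h, cycType_map_fst_sum]
  have hcard : Even (Multiset.card p.2) := by
    rw [← Sgn.neg_pow_eq_one_iff, ← signedType_map_snd_prod, ← h, cycType_map_snd_prod, hg]
  have hpos : ∀ x ∈ signedType p, 0 < x.1 := by
    intro x hx
    rw [← h, mem_cycType] at hx
    obtain ⟨i, rfl⟩ := hx
    exact cycLen_pos g i
  rw [oddDistinct_iff, evenNegative_iff, h, nodup_signedType]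
  constructor
  · constructor
    · rintro ⟨-, -, h1, h2⟩
      refine ⟨fun x hx => ?_, h1.2, h2.2⟩
      rcases mem_signedType.1 hx with hx | hx
      exacts [h1.1 _ hx.1, h2.1 _ hx.1]
    · rintro ⟨h1, h2⟩
      exact ⟨hsum, hcard, ⟨fun x hx => h1 (x, 1) (mem_signedType.2 (Or.inl ⟨hx, rfl⟩)), h2.1⟩,
        ⟨fun x hx => h1 (x, Sgn.neg) (mem_signedType.2 (Or.inr ⟨hx, rfl⟩)), h2.2⟩⟩
  · constructor
    · rintro ⟨h1, -, -, h2⟩ x hx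
      rcases mem_signedType.1 hx with hx | hx
      · simp [h1] at hx
      · exact ⟨(h2 _ hx.1).1, hx.2⟩
    · intro h1
      have h0 : p.1 = 0 := Multiset.eq_zero_of_forall_notMem fun x hx =>
        Sgn.neg_ne_one (h1 (x, 1) (mem_signedType.2 (Or.inl ⟨hx, rfl⟩))).2.symm
      refine ⟨h0, by simpa [h0] using hsum, hcard, fun x hx => ?_⟩
      have hx' : (x, Sgn.neg) ∈ signedType p := mem_signedType.2 (Or.inr ⟨hx, rfl⟩)
      exact ⟨(h1 _ hx').1, hpos _ hx'⟩

theorem exists_cycType_eq_signedType {p : Multiset ℕ × Multiset ℕ}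
    (hp : p ∈ oddLabels n ∪ evenLabels n) :
    ∃ g : Hyper n, cycType g = signedType p ∧ ∏ i, g.left i = 1 := by
  have h : (∀ x ∈ signedType p, 0 < x.1) ∧ p.1.sum + p.2.sum = n ∧
      Even (Multiset.card p.2) := by
    rcases hp with ⟨hs, hc, h1, h2⟩ | ⟨h0, hs, hc, h2⟩
    · refine ⟨fun x hx => ?_, hs, hc⟩
      rcases mem_signedType.1 hx with hx | hx
      exacts [(h1.1 _ hx.1).pos, (h2.1 _ hx.1).pos]
    · refine ⟨fun x hx => ?_, by simpa [h0] using hs, hc⟩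
      rcases mem_signedType.1 hx with hx | hx
      · simp [h0] at hx
      · exact (h2 _ hx.1).2
  obtain ⟨g, hg⟩ := exists_cycType_eq (n := n) (signedType p) h.1
    ((signedType_map_fst_sum p).trans h.2.1)
  refine ⟨g, hg, ?_⟩
  rw [← cycType_map_snd_prod, hg, signedType_map_snd_prod, Sgn.neg_pow_eq_one_iff]
  exact h.2.2

end Hyper

/-- Let `n ≥ 3` and let `W = D_n` be the kernel of the homomorphism
`H_n → ZMod 2` sending `(t,σ)` to `∑ᵢ tᵢ`, so that the sign character of `W` is
`ε(t,σ) = sign σ`.  Then the sign-isotypic subspace of the group algebra `k[W]` under the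
conjugation action has `k`-dimension `A + B`, where `A` is the number of pairs `(λ,μ)` with
`λ` a partition of some `m` (`0 ≤ m ≤ n`) into pairwise distinct odd parts, `μ` a partition
of `n−m` into pairwise distinct odd parts with an even number of parts (λ or μ possibly
empty), and `B` is the number of partitions `ν` of `n/2` with an even number of parts if `n`
is even, and `B = 0` if `n` is odd. -/
theorem dynkin_stmt12 (n : ℕ) (hn : 3 ≤ n) {k : Type*} [Field k] [CharZero k]
    (ψ : Hyper n →* Multiplicative (ZMod 2))
    (hψ : ∀ g : Hyper n, ψ g = ∏ i : Fin n, g.left i)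
    (ε : ψ.ker →* kˣ)
    (hε : ∀ g : ψ.ker, (ε g : k) = ((Equiv.Perm.sign (g : Hyper n).right : ℤ) : k)) :
    Module.finrank k (signIsotypic k ψ.ker (fun w => (ε w : k))) =
      Nat.card {x : Σ m : ℕ, Nat.Partition m × Nat.Partition (n - m) //
          x.1 ≤ n ∧ DistinctOddParts x.2.1 ∧ DistinctOddParts x.2.2 ∧
          Even (Multiset.card x.2.2.parts)} +
      (if Even n then
        Nat.card {nu : Nat.Partition (n / 2) // Even (Multiset.card nu.parts)}
      else 0) := by
  have : NeZero n := ⟨by omega⟩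
  have hker : ∀ g : Hyper n, g ∈ ψ.ker ↔ ∏ i, g.left i = 1 := fun g => by
    rw [MonoidHom.mem_ker, hψ]
  have hsign : ∀ w : ψ.ker, ε w = 1 ↔ Equiv.Perm.sign (w : Hyper n).right = 1 := fun w => by
    rw [← Units.val_eq_one, hε]
    norm_cast
    exact Units.val_eq_one
  have : Finite (Hyper n) := Finite.of_equiv _ SemidirectProduct.equivProd.symm
  have hex : ∀ p : ↥(Hyper.oddLabels n ∪ Hyper.evenLabels n), ∃ g : ψ.ker,
      Hyper.cycType (g : Hyper n) = Hyper.signedType p := fun p => by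
    obtain ⟨g, hg, h1⟩ := Hyper.exists_cycType_eq_signedType p.2
    exact ⟨⟨g, (hker g).2 h1⟩, hg⟩
  choose r hr using hex
  have hconj : ∀ p q (w : ψ.ker), w * r p * w⁻¹ = r q → p = q := by
    intro p q w h
    have h' : (w : Hyper n) * r p = r q * w :=
      congrArg Subtype.val (mul_inv_eq_iff_eq_mul.1 h)
    refine Subtype.ext (Hyper.signedType_bijective.injective ?_)
    rw [← hr, ← hr, Hyper.cycType_eq_of_conj h']
  have hfin : Finite ↥(Hyper.oddLabels n ∪ Hyper.evenLabels n) :=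
    Finite.of_injective r fun p q h => hconj p q 1 (by simpa using h)
  have hgood : ∀ p, Hyper.OddDistinct (r p : Hyper n) ∨ Hyper.EvenNegative (r p : Hyper n) := by
    intro p
    obtain ⟨h1, h2⟩ := Hyper.signedType_cases (hr p) ((hker _).1 (r p).2)
    exact p.2.imp h1.1 h2.1
  have hfin' := Set.toFinite (Hyper.oddLabels n ∪ Hyper.evenLabels n)
  rw [finrank_signIsotypic ε r, Hyper.card_oddLabels, Hyper.card_evenLabels,
    Nat.card_coe_set_eq, Nat.card_coe_set_eq, Nat.card_coe_set_eq,
    Set.ncard_union_eq Hyper.disjoint_labels (hfin'.subset Set.subset_union_left)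
      (hfin'.subset Set.subset_union_right)]
  · intro p w hw
    have h : Hyper.SignTrivial (r p : Hyper n) :=
      (hgood p).elim (fun h => h.signTrivial) fun h => h.signTrivial
    exact (hsign w).2 (h w (congrArg Subtype.val hw) ((hker _).1 w.2))
  · exact hconj
  · intro x hx
    have hx1 := (hker _).1 x.2
    have hxg : Hyper.SignTrivial (x : Hyper n) := fun c hc h1 =>
      (hsign ⟨c, (hker c).2 h1⟩).1 (hx _ (Subtype.ext hc))
    obtain ⟨p, hp⟩ := Hyper.signedType_bijective.surjective (Hyper.cycType (x : Hyper n))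
    obtain ⟨h1, h2⟩ := Hyper.signedType_cases hp.symm hx1
    let q : ↥(Hyper.oddLabels n ∪ Hyper.evenLabels n) :=
      ⟨p, hxg.oddDistinct_or_evenNegative.imp h1.2 h2.2⟩
    obtain ⟨w, hw, hwx⟩ := Hyper.exists_even_conj (hgood q) ((hr q).trans hp)
    exact ⟨q, ⟨w, (hker w).2 hw⟩, mul_inv_eq_iff_eq_mul.2 (Subtype.ext hwx)⟩
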